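/- There do not exist an ordinal κ and a sequence ⟨P_i : i ∈ ℕ⟩ of sets of ordinals such that: (a) P_0 ∩ κ belongs to some normal measure on κ; and (b) for every i ∈ ℕ, the set {β < κ : if β ∈ P_i then P_{i+1} ∩ β belongs to some normal measure on β} belongs to every normal measure on κ. (This witnesses that GL is not strongly complete with respect to the filter sequence of normal measures: the set Σ = {◇p_0} ∪ {□(p_i → ◇p_{i+1}) : i < ω} is unsatisfiable in that semantics.) -/

import Mathlib

/-- A normal measure on an ordinal `η`: an ultrafilter on the set of ordinals below `η`
(coded as a family of subsets of `Set.Iio η`) which is nonprincipal, `η`-complete and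
normal (closed under diagonal intersections). -/
structure IsNormalMeasure (η : Ordinal) (U : Set (Set Ordinal)) : Prop where
  subset_iio : ∀ X ∈ U, X ⊆ Set.Iio η
  univ_mem : Set.Iio η ∈ U
  superset_mem : ∀ X ∈ U, ∀ Y ⊆ Set.Iio η, X ⊆ Y → Y ∈ U
  inter_mem : ∀ X ∈ U, ∀ Y ∈ U, X ∩ Y ∈ U
  empty_not_mem : ∅ ∉ U
  ultra : ∀ X ⊆ Set.Iio η, X ∈ U ∨ (Set.Iio η \ X) ∈ U
  nonprincipal : ∀ α : Ordinal, {α} ∉ U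
  complete : ∀ θ < η, ∀ A : Ordinal → Set Ordinal, (∀ ξ < θ, A ξ ∈ U) →
      (Set.Iio η ∩ ⋂ ξ ∈ Set.Iio θ, A ξ) ∈ U
  normal : ∀ A : Ordinal → Set Ordinal, (∀ ξ < η, A ξ ∈ U) →
      {α | α < η ∧ ∀ ξ < α, α ∈ A ξ} ∈ U

/-- `MSet η` is the collection of all subsets of `η` belonging to every normal measure on `η`. -/
def MSet (η : Ordinal) : Set (Set Ordinal) :=
  {X | X ⊆ Set.Iio η ∧ ∀ U, IsNormalMeasure η U → X ∈ U}

/-- `g` witnesses `W ◁ U` (combinatorial Mitchell order) on `η`. -/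
def MitchellWitness (η : Ordinal) (g : Ordinal → Set (Set Ordinal))
    (W U : Set (Set Ordinal)) : Prop :=
  {ν | ν < η ∧ IsNormalMeasure ν (g ν)} ∈ U ∧
  W = {X | X ⊆ Set.Iio η ∧ {ν | ν < η ∧ X ∩ Set.Iio ν ∈ g ν} ∈ U}

/-- The combinatorial Mitchell order. -/
def MitchellLt (η : Ordinal) (W U : Set (Set Ordinal)) : Prop :=
  ∃ g, MitchellWitness η g W U

namespace IsNormalMeasure

variable {κ : Ordinal} {U : Set (Set Ordinal)}

theorem mono (h : IsNormalMeasure κ U) {X : Set Ordinal} (hX : X ∈ U) {p : Ordinal → Prop}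
    (hp : ∀ β < κ, β ∈ X → p β) : {β | β < κ ∧ p β} ∈ U :=
  h.superset_mem X hX _ (fun _ hb => hb.1)
    (fun _ hb => ⟨h.subset_iio X hX hb, hp _ (h.subset_iio X hX hb) hb⟩)

theorem nonempty (h : IsNormalMeasure κ U) {X : Set Ordinal} (hX : X ∈ U) : ∃ β, β ∈ X := by
  by_contra hne
  have : X = ∅ := Set.eq_empty_iff_forall_notMem.2 (fun x hx => hne ⟨x, hx⟩)
  exact h.empty_not_mem (this ▸ hX)

theorem not_subset_singleton (h : IsNormalMeasure κ U) {X : Set Ordinal} (hX : X ∈ U)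
    (ξ : Ordinal) : ¬ X ⊆ {ξ} := by
  intro hs
  rcases Set.subset_singleton_iff_eq.1 hs with h0 | h0
  · exact h.empty_not_mem (h0 ▸ hX)
  · exact h.nonprincipal ξ (h0 ▸ hX)

theorem ne_mem (h : IsNormalMeasure κ U) (ξ : Ordinal) : {β | β < κ ∧ β ≠ ξ} ∈ U := by
  rcases h.ultra {β | β < κ ∧ β ≠ ξ} (fun _ hb => hb.1) with h1 | h1
  · exact h1
  · refine absurd ?_ (h.not_subset_singleton h1 ξ)
    rintro β ⟨hb, hb2⟩
    by_contra hne
    exact hb2 ⟨hb, hne⟩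

theorem tail (h : IsNormalMeasure κ U) {θ : Ordinal} (hθ : θ < κ) :
    {β | β < κ ∧ θ < β} ∈ U := by
  have h1 := h.complete θ hθ (fun ξ => {β | β < κ ∧ β ≠ ξ}) (fun ξ _ => h.ne_mem ξ)
  refine h.mono (h.inter_mem _ h1 _ (h.ne_mem θ)) ?_
  rintro β hβ ⟨⟨_, h2⟩, _, h3⟩
  by_contra hle
  have hlt : β < θ := lt_of_le_of_ne (not_lt.1 hle) h3
  have := Set.mem_iInter₂.1 h2 β hlt
  exact this.2 rfl

theorem omega_lt (h : IsNormalMeasure κ U) : Ordinal.omega0 < κ := by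
  by_contra hle
  have hle := not_lt.1 hle
  have h1 := h.normal (fun ξ => {β | β < κ ∧ β ≠ ξ + 1}) (fun ξ _ => h.ne_mem _)
  refine h.not_subset_singleton h1 0 ?_
  rintro α ⟨hα, h2⟩
  obtain ⟨n, rfl⟩ := Ordinal.lt_omega0.1 (hα.trans_le hle)
  cases n with
  | zero => simp
  | succ n =>
    exact absurd (by push_cast; rfl) (h2 (n : Ordinal) (by exact_mod_cast Nat.lt_succ_self n)).2

theorem countable (h : IsNormalMeasure κ U) (p : ℕ → Ordinal → Prop)
    (hp : ∀ n, {β | β < κ ∧ p n β} ∈ U) : {β | β < κ ∧ ∀ n, p n β} ∈ U := by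
  have h1 := h.complete _ h.omega_lt
    (fun ξ => {β | β < κ ∧ ∀ n : ℕ, (n : Ordinal) = ξ → p n β}) (by
      intro ξ hξ
      obtain ⟨n, rfl⟩ := Ordinal.lt_omega0.1 hξ
      refine h.mono (hp n) ?_
      rintro β _ hb m hm
      have : m = n := by exact_mod_cast hm
      exact this ▸ hb.2)
  refine h.mono h1 ?_
  rintro β _ ⟨_, h2⟩ n
  exact (Set.mem_iInter₂.1 h2 (n : Ordinal) (Ordinal.natCast_lt_omega0 n)).2 n rfl

/-- The measure represented by `g` in the ultrapower by `U`. -/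
theorem limit (h : IsNormalMeasure κ U) (g : Ordinal → Set (Set Ordinal))
    (hg : {β | β < κ ∧ IsNormalMeasure β (g β)} ∈ U) :
    IsNormalMeasure κ {X | X ⊆ Set.Iio κ ∧ {β | β < κ ∧ X ∩ Set.Iio β ∈ g β} ∈ U} where
  subset_iio X hX := hX.1
  univ_mem := by
    refine ⟨subset_rfl, h.mono hg ?_⟩
    rintro β hβ ⟨_, hb⟩
    exact hb.superset_mem _ hb.univ_mem _ Set.inter_subset_right
      (fun x hx => ⟨lt_trans hx hβ, hx⟩)
  superset_mem := by
    rintro X ⟨_, hX⟩ Y hY hXY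
    refine ⟨hY, h.mono (h.inter_mem _ hg _ hX) ?_⟩
    rintro β hβ ⟨⟨_, hb⟩, _, hx⟩
    exact hb.superset_mem _ hx _ Set.inter_subset_right (Set.inter_subset_inter_left _ hXY)
  inter_mem := by
    rintro X ⟨hX0, hX⟩ Y ⟨_, hY⟩
    refine ⟨Set.inter_subset_left.trans hX0,
      h.mono (h.inter_mem _ hg _ (h.inter_mem _ hX _ hY)) ?_⟩
    rintro β hβ ⟨⟨_, hb⟩, ⟨_, hx⟩, _, hy⟩
    exact hb.superset_mem _ (hb.inter_mem _ hx _ hy) _ Set.inter_subset_right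
      (fun x hx => ⟨⟨hx.1.1, hx.2.1⟩, hx.1.2⟩)
  empty_not_mem := by
    rintro ⟨_, hX⟩
    obtain ⟨β, ⟨_, hb⟩, _, hx⟩ := h.nonempty (h.inter_mem _ hg _ hX)
    rw [Set.empty_inter] at hx
    exact hb.empty_not_mem hx
  ultra := by
    intro X hX
    rcases h.ultra {β | β < κ ∧ X ∩ Set.Iio β ∈ g β} (fun _ hb => hb.1) with h1 | h1
    · exact Or.inl ⟨hX, h1⟩
    · refine Or.inr ⟨Set.diff_subset, h.mono (h.inter_mem _ hg _ h1) ?_⟩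
      rintro β hβ ⟨⟨_, hb⟩, _, hx⟩
      rcases hb.ultra (X ∩ Set.Iio β) Set.inter_subset_right with h2 | h2
      · exact absurd ⟨hβ, h2⟩ hx
      · exact hb.superset_mem _ h2 _ Set.inter_subset_right
          (fun x hx => ⟨⟨lt_trans hx.1 hβ, fun hxX => hx.2 ⟨hxX, hx.1⟩⟩, hx.1⟩)
  nonprincipal := by
    rintro α ⟨_, hX⟩
    obtain ⟨β, ⟨_, hb⟩, _, hx⟩ := h.nonempty (h.inter_mem _ hg _ hX)
    exact hb.not_subset_singleton hx α Set.inter_subset_left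
  complete := by
    intro θ hθ A hA
    refine ⟨Set.inter_subset_left, ?_⟩
    have h1 := h.complete θ hθ (fun ξ => {β | β < κ ∧ A ξ ∩ Set.Iio β ∈ g β})
      (fun ξ hξ => (hA ξ hξ).2)
    refine h.mono (h.inter_mem _ hg _ (h.inter_mem _ (h.tail hθ) _ h1)) ?_
    rintro β hβ ⟨⟨_, hb⟩, ⟨_, hθβ⟩, _, hx⟩
    have h2 := hb.complete θ hθβ (fun ξ => A ξ ∩ Set.Iio β)
      (fun ξ hξ => (Set.mem_iInter₂.1 hx ξ hξ).2)
    refine hb.superset_mem _ h2 _ Set.inter_subset_right ?_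
    rintro x ⟨hxβ, hxA⟩
    exact ⟨⟨lt_trans hxβ hβ, Set.mem_iInter₂.2 fun ξ hξ => (Set.mem_iInter₂.1 hxA ξ hξ).1⟩, hxβ⟩
  normal := by
    intro A hA
    refine ⟨fun _ hb => hb.1, ?_⟩
    have h1 := h.normal (fun ξ => {β | β < κ ∧ A ξ ∩ Set.Iio β ∈ g β})
      (fun ξ hξ => (hA ξ hξ).2)
    refine h.mono (h.inter_mem _ hg _ h1) ?_
    rintro β hβ ⟨⟨_, hb⟩, _, hx⟩
    have h2 := hb.normal (fun ξ => A ξ ∩ Set.Iio β) (fun ξ hξ => (hx ξ hξ).2)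
    refine hb.superset_mem _ h2 _ Set.inter_subset_right ?_
    rintro x ⟨hxβ, hxA⟩
    exact ⟨⟨lt_trans hxβ hβ, fun ξ hξ => (hxA ξ hξ).1⟩, hxβ⟩

/-- Reflection: a set in every normal measure on `κ` reflects `U`-almost everywhere. -/
theorem reflect (h : IsNormalMeasure κ U) (B : Set Ordinal)
    (hB : ∀ V, IsNormalMeasure κ V → B ∈ V) :
    {β | β < κ ∧ ∀ W, IsNormalMeasure β W → B ∩ Set.Iio β ∈ W} ∈ U := by
  rcases h.ultra {β | β < κ ∧ ∀ W, IsNormalMeasure β W → B ∩ Set.Iio β ∈ W}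
    (fun _ hb => hb.1) with h1 | h1
  · exact h1
  exfalso
  have hex : ∀ β, ∃ W, (β < κ ∧ ¬ ∀ W, IsNormalMeasure β W → B ∩ Set.Iio β ∈ W) →
      IsNormalMeasure β W ∧ B ∩ Set.Iio β ∉ W := by
    intro β
    by_cases hc : β < κ ∧ ¬ ∀ W, IsNormalMeasure β W → B ∩ Set.Iio β ∈ W
    · have hc2 := hc.2
      push Not at hc2
      obtain ⟨W, hW⟩ := hc2
      exact ⟨W, fun _ => hW⟩
    · exact ⟨∅, fun hc' => absurd hc' hc⟩
  choose g hg using hex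
  have hlim := h.limit g (h.mono h1 (fun β hβ hb => (hg β ⟨hβ, fun hc => hb.2 ⟨hβ, hc⟩⟩).1))
  obtain ⟨β, ⟨hβ, hb⟩, _, hx⟩ := h.nonempty (h.inter_mem _ h1 _ (hB _ hlim).2)
  exact (hg β ⟨hβ, fun hc => hb ⟨hβ, hc⟩⟩).2 hx

end IsNormalMeasure

/-- GL is not strongly complete for the normal-measure semantics: there are no `κ` and
sets `P i` of ordinals such that `P 0 ∩ κ` belongs to some normal measure on `κ` and,
for each `i`, the set `{β < κ : β ∈ P i → P (i+1) ∩ β` belongs to some normal measure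
on `β}` belongs to every normal measure on `κ`. -/
theorem no_descending_diamond_sequence :
    ¬ ∃ (κ : Ordinal) (P : ℕ → Set Ordinal),
      (∃ U, IsNormalMeasure κ U ∧ P 0 ∩ Set.Iio κ ∈ U) ∧
      (∀ i : ℕ, ∀ U, IsNormalMeasure κ U →
        {β | β < κ ∧ (β ∈ P i →
          ∃ W, IsNormalMeasure β W ∧ P (i + 1) ∩ Set.Iio β ∈ W)} ∈ U) := by
  rintro ⟨κ, P, h⟩
  induction κ using WellFoundedLT.induction generalizing P with
  | ind κ ih =>
    obtain ⟨⟨U, hU, hP⟩, hB⟩ := h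
    have h1 := hU.countable _ (fun i => hU.reflect _ (hB i))
    obtain ⟨β, ⟨hβ, hr⟩, ⟨hP0, _⟩, _, hd⟩ :=
      hU.nonempty (hU.inter_mem _ h1 _ (hU.inter_mem _ hP _ (hB 0 U hU)))
    refine ih β hβ (fun i => P (i + 1)) ⟨hd hP0, ?_⟩
    intro i W hW
    refine hW.mono (hr (i + 1) W hW) ?_
    rintro γ _ ⟨⟨_, hγ⟩, _⟩
    exact hγ
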